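/- For every H ∈ E and every w ∈ W, one has wH − H ∈ Γ₀ if and only if w ∈ W₀(H); that is, the centralizer of H modulo the fundamental lattice, {w ∈ W : wH ∈ H + Γ₀}, coincides with the reflection subgroup W₀(H). -/

import Mathlib

open scoped RealInnerProductSpace

namespace AffRefl

variable {E : Type*} [NormedAddCommGroup E] [InnerProductSpace ℝ E]

/-- Data of a locally finite family of affine reflections with a generic base point. -/
structure Sys (T : Set (Equiv.Perm E)) (U : Equiv.Perm E → E) (C : Equiv.Perm E → ℝ) (x : E) :
    Prop where
  hU : ∀ t ∈ T, ‖U t‖ = 1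
  ht : ∀ t ∈ T, ∀ y, t y = y - (2 * (⟪U t, y⟫ - C t)) • U t
  hpos : ∀ t ∈ T, 0 < ⟪U t, x⟫ - C t
  hconj : ∀ s ∈ T, ∀ t ∈ T, s * t * s ∈ T
  hfin : ∀ y, {t | t ∈ T ∧ ⟪U t, y⟫ - C t < 0}.Finite

variable {T : Set (Equiv.Perm E)} {U : Equiv.Perm E → E} {C : Equiv.Perm E → ℝ} {x : E}

namespace Sys

lemma inner_self (S : Sys T U C x) {t} (h : t ∈ T) : ⟪U t, U t⟫ = 1 := by
  rw [real_inner_self_eq_norm_sq, S.hU t h]; norm_num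

lemma F_self (S : Sys T U C x) {t} (h : t ∈ T) (y : E) : ⟪U t, t y⟫ - C t = -(⟪U t, y⟫ - C t) := by
  rw [S.ht t h, inner_sub_right, inner_smul_right, S.inner_self h]; ring

lemma sq (S : Sys T U C x) {t} (h : t ∈ T) : t * t = 1 := by
  ext y
  simp only [Equiv.Perm.mul_apply, Equiv.Perm.one_apply]
  rw [S.ht t h (t y), S.F_self h, S.ht t h y]
  module

lemma inv (S : Sys T U C x) {t} (h : t ∈ T) : t⁻¹ = t := inv_eq_of_mul_eq_one_left (S.sq h)

/-- uniqueness of normalized representative -/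
lemma uniq (S : Sys T U C x) {t} (h : t ∈ T) {u : E} {c : ℝ} (hu : ‖u‖ = 1)
    (hx : t x = x - (2 * (⟪u, x⟫ - c)) • u) (hp : 0 < ⟪u, x⟫ - c) : U t = u ∧ C t = c := by
  have h1 := S.ht t h x
  have h2 : (⟪U t, x⟫ - C t) • U t = (⟪u, x⟫ - c) • u := by
    have h3 : (2 * (⟪u, x⟫ - c)) • u = (2 * (⟪U t, x⟫ - C t)) • U t := by
      rw [hx] at h1
      exact sub_right_injective h1
    rw [mul_smul, mul_smul] at h3
    exact (smul_right_injective E (two_ne_zero (α := ℝ)) h3).symm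
  have h4 : ⟪U t, x⟫ - C t = ⟪u, x⟫ - c := by
    have := congrArg norm h2
    rw [norm_smul, norm_smul, hu, S.hU t h, Real.norm_of_nonneg hp.le,
      Real.norm_of_nonneg (S.hpos t h).le] at this
    linarith
  have h5 : U t = u := by
    rw [h4] at h2
    exact smul_right_injective E hp.ne' h2
  refine ⟨h5, ?_⟩
  rw [h5] at h4
  linarith

lemma conj_gen (S : Sys T U C x) {s t} (hs : s ∈ T) (h : t ∈ T) :
    (∀ y, ⟪U (s * t * s), y⟫ - C (s * t * s) = ⟪U t, s y⟫ - C t) ∨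
    (∀ y, ⟪U (s * t * s), y⟫ - C (s * t * s) = -(⟪U t, s y⟫ - C t)) := by
  have hm := S.hconj s hs t h
  set k := ⟪U s, U t⟫ with hk
  set v := U t - (2 * k) • U s with hv
  have hss := S.inner_self hs
  have htt := S.inner_self h
  have hvv : ‖v‖ = 1 := by
    have : ⟪v, v⟫ = 1 := by
      simp only [hv, inner_sub_left, inner_sub_right, inner_smul_left, inner_smul_right, hss, htt,
        real_inner_comm (U s) (U t)]
      simp [← hk]
      ring
    rw [real_inner_self_eq_norm_sq] at this
    nlinarith [norm_nonneg v]
  have hkt : ⟪U t, U s⟫ = k := by rw [real_inner_comm]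
  have hF : ∀ y, ⟪U t, s y⟫ - C t = ⟪v, y⟫ - (C t - 2 * k * C s) := by
    intro y
    rw [S.ht s hs, hv]
    simp only [inner_sub_left, inner_sub_right, inner_smul_left, inner_smul_right, hkt]
    simp
    ring
  have hap : ∀ y, (s * t * s) y = y - (2 * (⟪v, y⟫ - (C t - 2 * k * C s))) • v := by
    intro y
    simp only [Equiv.Perm.mul_apply]
    rw [S.ht t h (s y), hF y]
    generalize ⟪v, y⟫ - (C t - 2 * k * C s) = a
    have hself := S.F_self hs y
    have e : ⟪U s, s y⟫ = 2 * C s - ⟪U s, y⟫ := by linarith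
    rw [S.ht s hs, inner_sub_right, inner_smul_right, ← hk, e, S.ht s hs y, hv]
    module
  have hne : ⟪U t, s x⟫ - C t ≠ 0 := by
    intro h0
    have h1 : (s * t * s) x = x := by
      rw [hap, ← hF, h0]; simp
    have h2 := S.F_self hm x
    rw [h1] at h2
    have := S.hpos _ hm
    linarith
  rcases lt_or_gt_of_ne hne with hlt | hgt
  · right
    obtain ⟨h1, h2⟩ := S.uniq hm (u := -v) (c := -(C t - 2 * k * C s)) (by rw [norm_neg, hvv])
      (by rw [hap, inner_neg_left]; module) (by rw [hF] at hlt; rw [inner_neg_left]; linarith)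
    intro y
    rw [h1, h2, hF, inner_neg_left]; ring
  · left
    obtain ⟨h1, h2⟩ := S.uniq hm hvv (hap x) (by rw [hF] at hgt; exact hgt)
    intro y
    rw [h1, h2, hF]

lemma conj (S : Sys T U C x) {g} (hg : g ∈ Subgroup.closure T) : ∀ t ∈ T, g⁻¹ * t * g ∈ T ∧
    ((∀ y, ⟪U (g⁻¹ * t * g), y⟫ - C (g⁻¹ * t * g) = ⟪U t, g y⟫ - C t) ∨
    (∀ y, ⟪U (g⁻¹ * t * g), y⟫ - C (g⁻¹ * t * g) = -(⟪U t, g y⟫ - C t))) := by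
  have key : ∀ s ∈ T, ∀ y : Equiv.Perm E, (∀ t ∈ T, y⁻¹ * t * y ∈ T ∧
    ((∀ z, ⟪U (y⁻¹ * t * y), z⟫ - C (y⁻¹ * t * y) = ⟪U t, y z⟫ - C t) ∨
    (∀ z, ⟪U (y⁻¹ * t * y), z⟫ - C (y⁻¹ * t * y) = -(⟪U t, y z⟫ - C t)))) →
    (∀ t ∈ T, (s * y)⁻¹ * t * (s * y) ∈ T ∧
    ((∀ z, ⟪U ((s * y)⁻¹ * t * (s * y)), z⟫ - C ((s * y)⁻¹ * t * (s * y)) = ⟪U t, (s * y) z⟫ - C t) ∨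
    (∀ z, ⟪U ((s * y)⁻¹ * t * (s * y)), z⟫ - C ((s * y)⁻¹ * t * (s * y)) =
      -(⟪U t, (s * y) z⟫ - C t)))) := by
    intro s hs y ih t ht
    have e : (s * y)⁻¹ * t * (s * y) = y⁻¹ * (s * t * s) * y := by
      rw [mul_inv_rev, S.inv hs]; group
    rw [e]
    obtain ⟨h1, h2⟩ := ih _ (S.hconj s hs t ht)
    refine ⟨h1, ?_⟩
    simp only [Equiv.Perm.mul_apply]
    rcases h2 with h2 | h2 <;> rcases S.conj_gen hs ht with h3 | h3
    · left; intro z; rw [h2, h3]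
    · right; intro z; rw [h2, h3]
    · right; intro z; rw [h2, h3]
    · left; intro z; rw [h2, h3]; ring
  induction hg using Subgroup.closure_induction_left with
  | one => intro t ht; simpa using ht
  | mul_left s hs y hy ih => exact key s hs y ih
  | inv_mul_cancel s hs y hy ih => rw [S.inv hs]; exact key s hs y ih

lemma ne_zero (S : Sys T U C x) {g} (hg : g ∈ Subgroup.closure T) {t} (h : t ∈ T) : ⟪U t, g x⟫ - C t ≠ 0 := by
  obtain ⟨h1, h2⟩ := S.conj hg t h
  have := S.hpos _ h1
  rcases h2 with h2 | h2 <;> rw [h2] at this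
  · exact this.ne'
  · intro h0; rw [h0] at this; simp at this

/-- inversion set -/
def N (T : Set (Equiv.Perm E)) (U : Equiv.Perm E → E) (C : Equiv.Perm E → ℝ) (x : E)
    (g : Equiv.Perm E) : Set (Equiv.Perm E) := {t | t ∈ T ∧ ⟪U t, g x⟫ - C t < 0}

/-- simple reflections -/
def Simple (T : Set (Equiv.Perm E)) (U : Equiv.Perm E → E) (C : Equiv.Perm E → ℝ) (x : E) :
    Set (Equiv.Perm E) := {s | s ∈ T ∧ ∀ t ∈ T, t ≠ s → 0 < ⟪U t, s x⟫ - C t}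

/-- left multiplication by a simple reflection -/
lemma simple_conj (S : Sys T U C x) {s} (hs : s ∈ Simple T U C x) {t} (ht : t ∈ T) (hts : t ≠ s) (y : E) :
    ⟪U (s * t * s), y⟫ - C (s * t * s) = ⟪U t, s y⟫ - C t := by
  rcases S.conj_gen hs.1 ht with h | h
  · exact h y
  · have h1 := h x
    have h2 := hs.2 t ht hts
    have h3 := S.hpos _ (S.hconj s hs.1 t ht)
    linarith

lemma simple_ne (S : Sys T U C x) {s t} (hs : s ∈ T) (hts : t ≠ s) : s * t * s ≠ s := by
  intro h
  apply hts
  have : s * (s * t * s) * s = s * s * s := by rw [h]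
  have e : s * (s * t * s) * s = (s * s) * t * (s * s) := by group
  rw [e, S.sq hs] at this
  simpa using this

lemma N_mul (S : Sys T U C x) {s} (hs : s ∈ Simple T U C x) {g}
    (hsg : s ∈ N T U C x g) : (N T U C x (s * g)).ncard < (N T U C x g).ncard := by
  have hsub : N T U C x (s * g) ⊆ (fun t => s * t * s) '' (N T U C x g \ {s}) := by
    rintro t ⟨ht, htn⟩
    have hts : t ≠ s := by
      rintro rfl
      have := S.F_self ht (g x)
      have h2 := hsg.2
      rw [Equiv.Perm.mul_apply] at htn
      linarith
    refine ⟨s * t * s, ⟨⟨S.hconj s hs.1 t ht, ?_⟩, S.simple_ne hs.1 hts⟩, ?_⟩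
    · rw [S.simple_conj hs ht hts]; exact htn
    · have e : s * (s * t * s) * s = (s * s) * t * (s * s) := by group
      simp only [e, S.sq hs.1]; simp
  have hf : (N T U C x g).Finite := S.hfin (g x)
  calc _ ≤ ((fun t => s * t * s) '' (N T U C x g \ {s})).ncard :=
        Set.ncard_le_ncard hsub ((hf.sdiff).image _)
    _ ≤ (N T U C x g \ {s}).ncard := Set.ncard_image_le hf.sdiff
    _ < _ := Set.ncard_sdiff_singleton_lt_of_mem hsg hf

lemma exchange (S : Sys T U C x) (L : List (Equiv.Perm E)) (hL : ∀ s ∈ L, s ∈ Simple T U C x) :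
    ∀ t ∈ N T U C x L.prod, ∃ L' : List (Equiv.Perm E), (∀ s ∈ L', s ∈ Simple T U C x) ∧
      L'.length < L.length ∧ L'.prod = t * L.prod := by
  induction L with
  | nil =>
    rintro t ⟨ht, h⟩
    have := S.hpos t ht
    simp at h; linarith
  | cons s M ih =>
    rintro t ⟨ht, h⟩
    have hs := hL s (by simp)
    by_cases hts : t = s
    · subst hts
      refine ⟨M, fun u hu => hL u (by simp [hu]), by simp, ?_⟩
      rw [List.prod_cons, ← mul_assoc, S.sq ht, one_mul]
    · obtain ⟨M', h1, h2, h3⟩ := ih (fun u hu => hL u (by simp [hu])) (s * t * s)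
        ⟨S.hconj s hs.1 t ht, by
          rw [S.simple_conj hs ht hts]; rw [List.prod_cons] at h; exact h⟩
      refine ⟨s :: M', ?_, by simpa using h2, ?_⟩
      · intro u hu
        rcases List.mem_cons.1 hu with rfl | hu
        · exact hs
        · exact h1 u hu
      · rw [List.prod_cons, h3, List.prod_cons]
        have e : s * (s * t * s * M.prod) = (s * s) * t * s * M.prod := by group
        rw [e, S.sq hs.1]; group

lemma exists_simple (S : Sys T U C x) {g} (hg : g ∈ Subgroup.closure T) (hne : (N T U C x g).Nonempty) :
    ∃ s ∈ N T U C x g, s ∈ Simple T U C x := by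
  have hf : (N T U C x g).Finite := S.hfin (g x)
  let p : Equiv.Perm E → ℝ := fun t => ⟪U t, x⟫ - C t
  let q : Equiv.Perm E → ℝ := fun t => ⟪U t, g x⟫ - C t
  obtain ⟨s, hs, hmin⟩ := Set.exists_min_image (N T U C x g)
    (fun t => toLex (p t / (-q t), p t)) hf hne
  refine ⟨s, hs, hs.1, ?_⟩
  intro t ht hts
  by_contra hcon
  have hst : ⟪U t, s x⟫ - C t < 0 :=
    lt_of_le_of_ne (not_lt.1 hcon) (S.ne_zero (Subgroup.subset_closure hs.1) ht)
  have hr := S.hconj s hs.1 t ht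
  set r := s * t * s with hrdef
  set k := ⟪U s, U t⟫ with hk
  have hFt : ∀ y, ⟪U t, s y⟫ - C t = (⟪U t, y⟫ - C t) - 2 * k * (⟪U s, y⟫ - C s) := by
    intro y
    rw [S.ht s hs.1, inner_sub_right, inner_smul_right, real_inner_comm (U s) (U t), ← hk]
    ring
  have hFr : ∀ y, ⟪U r, y⟫ - C r = -(⟪U t, s y⟫ - C t) := by
    rcases S.conj_gen hs.1 ht with h | h
    · have := h x
      have := S.hpos r hr
      linarith
    · exact h
  have hsum : ∀ y, (⟪U t, y⟫ - C t) + (⟪U r, y⟫ - C r) = 2 * k * (⟪U s, y⟫ - C s) := by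
    intro y; rw [hFr, hFt]; ring
  have hp := hsum x
  have hq := hsum (g x)
  have p1 : 0 < p s := S.hpos s hs.1
  have p2 : 0 < p t := S.hpos t ht
  have p3 : 0 < p r := S.hpos r hr
  have q1 : q s < 0 := hs.2
  change p t + p r = 2 * k * p s at hp
  change q t + q r = 2 * k * q s at hq
  have hk1 : k ≤ 1 := by
    have := real_inner_le_norm (U s) (U t)
    rw [S.hU s hs.1, S.hU t ht] at this
    linarith
  have hle : ∀ i ∈ T, p i * q s ≤ p s * q i := by
    intro i hi
    have pi : 0 < p i := S.hpos i hi
    by_cases hqi : q i < 0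
    · have := hmin i ⟨hi, hqi⟩
      rw [Prod.Lex.toLex_le_toLex] at this
      have h2 : p s / (-q s) ≤ p i / (-q i) := by
        rcases this with h | h
        · exact h.le
        · exact h.1.le
      rw [div_le_div_iff₀ (by linarith) (by linarith)] at h2
      linarith
    · have : 0 ≤ p s * q i := mul_nonneg p1.le (not_lt.1 hqi)
      nlinarith
  have ht1 := hle t ht
  have hr1 := hle r hr
  have hs2 : p s * q t + p s * q r = p t * q s + p r * q s := by
    rw [← mul_add, hq, ← add_mul, hp]; ring
  have ht2 : p t * q s = p s * q t := by linarith
  have hr2 : p r * q s = p s * q r := by linarith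
  have tie : ∀ i ∈ T, p i * q s = p s * q i → p s ≤ p i := by
    intro i hi he
    have pi : 0 < p i := S.hpos i hi
    have hqi : q i < 0 := by
      by_contra h
      have : 0 ≤ p s * q i := mul_nonneg p1.le (not_lt.1 h)
      nlinarith
    have := hmin i ⟨hi, hqi⟩
    rw [Prod.Lex.toLex_le_toLex] at this
    rcases this with h | h
    · have h : p s / (-q s) < p i / (-q i) := h
      rw [div_lt_div_iff₀ (by linarith) (by linarith)] at h
      linarith
    · exact h.2
  have ht3 := tie t ht ht2
  have hr3 := tie r hr hr2
  have hk2 : k = 1 := by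
    apply le_antisymm hk1
    by_contra h
    nlinarith
  have hpt : p t = p s := by rw [hk2] at hp; linarith
  have hUU : U s = U t :=
    (inner_eq_one_iff_of_norm_eq_one (𝕜 := ℝ) (S.hU s hs.1) (S.hU t ht)).1 hk2
  have hCC : C s = C t := by
    have : ⟪U t, x⟫ - C t = ⟪U s, x⟫ - C s := hpt
    rw [hUU] at this
    linarith
  apply hts
  ext y
  rw [S.ht t ht, S.ht s hs.1, hUU, hCC]

lemma decomp (S : Sys T U C x) (n : ℕ) : ∀ g ∈ Subgroup.closure T, (N T U C x g).ncard = n →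
    ∃ L : List (Equiv.Perm E), (∀ s ∈ L, s ∈ Simple T U C x) ∧
      ∃ w ∈ Subgroup.closure T, N T U C x w = ∅ ∧ g = L.prod * w := by
  induction n using Nat.strong_induction_on with
  | _ n ih =>
    intro g hg hn
    rcases Set.eq_empty_or_nonempty (N T U C x g) with h | h
    · exact ⟨[], by simp, g, hg, h, by simp⟩
    · obtain ⟨s, hs, hs2⟩ := S.exists_simple hg h
      obtain ⟨L, hL, w, hw, hw2, e⟩ := ih _ (hn ▸ S.N_mul hs2 hs) (s * g)
        (mul_mem (Subgroup.subset_closure hs.1) hg) rfl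
      refine ⟨s :: L, ?_, w, hw, hw2, ?_⟩
      · intro u hu
        rcases List.mem_cons.1 hu with rfl | hu
        · exact hs2
        · exact hL u hu
      · rw [List.prod_cons, mul_assoc, ← e, ← mul_assoc, S.sq hs.1, one_mul]

lemma list_mem (_S : Sys T U C x) (L : List (Equiv.Perm E)) (hL : ∀ s ∈ L, s ∈ Simple T U C x) :
    L.prod ∈ Subgroup.closure (Simple T U C x) :=
  list_prod_mem fun s hs => Subgroup.subset_closure (hL s hs)

lemma le_closure (_S : Sys T U C x) : Subgroup.closure (Simple T U C x) ≤ Subgroup.closure T :=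
  Subgroup.closure_mono fun _ h => h.1

lemma closure_simple (S : Sys T U C x) : Subgroup.closure T = Subgroup.closure (Simple T U C x) := by
  apply le_antisymm _ S.le_closure
  rw [Subgroup.closure_le]
  intro t ht
  have htc : t ∈ Subgroup.closure T := Subgroup.subset_closure ht
  obtain ⟨L, hL, w, hw, hw2, e⟩ := S.decomp _ t htc rfl
  have hp := S.le_closure (S.list_mem L hL)
  have hmem : t ∈ N T U C x L.prod := by
    refine ⟨ht, ?_⟩
    obtain ⟨h1, h2⟩ := S.conj hp t ht
    have hwpos : 0 < ⟪U (L.prod⁻¹ * t * L.prod), w x⟫ - C (L.prod⁻¹ * t * L.prod) := by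
      by_contra hcon
      have : (L.prod⁻¹ * t * L.prod) ∈ N T U C x w :=
        ⟨h1, lt_of_le_of_ne (not_lt.1 hcon) (S.ne_zero hw h1)⟩
      rw [hw2] at this
      exact this
    have hxpos := S.hpos _ h1
    have hneg : ⟪U t, L.prod (w x)⟫ - C t < 0 := by
      have h3 : L.prod (w x) = t x := by rw [← Equiv.Perm.mul_apply, ← e]
      rw [h3, S.F_self ht]
      have := S.hpos t ht
      linarith
    rcases h2 with h2 | h2
    · rw [h2] at hwpos; linarith
    · rw [h2] at hxpos; linarith
  obtain ⟨L', hL', -, e'⟩ := S.exchange L hL t hmem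
  have e2 : L.prod = t⁻¹ * L'.prod := by rw [e']; group
  have e3 : w = L'.prod⁻¹ := by
    have : t * L.prod * w = 1 := by rw [mul_assoc, ← e, S.sq ht]
    rw [← e'] at this
    exact (inv_eq_of_mul_eq_one_right this).symm
  rw [e, e3]
  exact mul_mem (S.list_mem L hL) (inv_mem (S.list_mem L' hL'))

lemma exists_list (S : Sys T U C x) {g} (hg : g ∈ Subgroup.closure T) :
    ∃ L : List (Equiv.Perm E), (∀ s ∈ L, s ∈ Simple T U C x) ∧ L.prod = g := by
  rw [S.closure_simple] at hg
  have key : ∀ s ∈ Simple T U C x, ∀ y : Equiv.Perm E,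
      (∃ L : List (Equiv.Perm E), (∀ s ∈ L, s ∈ Simple T U C x) ∧ L.prod = y) →
      ∃ L : List (Equiv.Perm E), (∀ s ∈ L, s ∈ Simple T U C x) ∧ L.prod = s * y := by
    rintro s hs y ⟨L, hL, rfl⟩
    refine ⟨s :: L, ?_, by simp⟩
    intro u hu
    rcases List.mem_cons.1 hu with rfl | hu
    · exact hs
    · exact hL u hu
  induction hg using Subgroup.closure_induction_left with
  | one => exact ⟨[], by simp, by simp⟩
  | mul_left s hs y hy ih => exact key s hs y ih
  | inv_mul_cancel s hs y hy ih => rw [S.inv hs.1]; exact key s hs y ih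

/-- Stabilizers of points in the closed fundamental chamber are generated by reflections. -/
theorem stab (S : Sys T U C x) (y : E) (hy : ∀ t ∈ T, 0 ≤ ⟪U t, y⟫ - C t) (n : ℕ) :
    ∀ L : List (Equiv.Perm E), (∀ s ∈ L, s ∈ Simple T U C x) → L.length = n → L.prod y = y →
      L.prod ∈ Subgroup.closure {t | t ∈ T ∧ t y = y} := by
  induction n using Nat.strong_induction_on with
  | _ n ih =>
    intro L hL hn hLy
    cases L with
    | nil => simp
    | cons s M =>
      have hs := hL s (by simp)
      have hM : ∀ u ∈ M, u ∈ Simple T U C x := fun u hu => hL u (by simp [hu])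
      have hMc := S.le_closure (S.list_mem M hM)
      have hgc := S.le_closure (S.list_mem _ hL)
      have hn' : M.length + 1 = n := by simpa using hn
      by_cases hneg : ⟪U s, M.prod x⟫ - C s < 0
      · obtain ⟨L', h1, h2, h3⟩ := S.exchange M hM s ⟨hs.1, hneg⟩
        rw [← List.prod_cons] at h3
        rw [← h3] at hLy ⊢
        exact ih L'.length (by omega) L' h1 rfl hLy
      · have hpos : 0 < ⟪U s, M.prod x⟫ - C s :=
          lt_of_le_of_ne (not_lt.1 hneg) (S.ne_zero hMc hs.1).symm
        have hF0 : ⟪U s, y⟫ - C s = 0 := by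
          apply le_antisymm _ (hy s hs.1)
          obtain ⟨h1, h2⟩ := S.conj hgc s hs.1
          have hx := S.hpos _ h1
          have hyy := hy _ h1
          have : ⟪U s, (s :: M).prod x⟫ - C s < 0 := by
            rw [List.prod_cons, Equiv.Perm.mul_apply, S.F_self hs.1]; linarith
          rcases h2 with h2 | h2
          · rw [h2] at hx; linarith
          · rw [h2, hLy] at hyy; linarith
        have hsy : s y = y := by rw [S.ht s hs.1, hF0]; simp
        have hMy : M.prod y = y := by
          rw [List.prod_cons, Equiv.Perm.mul_apply] at hLy
          exact s.injective (hLy.trans hsy.symm)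
        rw [List.prod_cons]
        exact mul_mem (Subgroup.subset_closure ⟨hs.1, hsy⟩) (ih M.length (by omega) M hM rfl hMy)

theorem stab' (S : Sys T U C x) (y : E) (hy : ∀ t ∈ T, 0 ≤ ⟪U t, y⟫ - C t) {g} (hg : g ∈ Subgroup.closure T)
    (hgy : g y = y) : g ∈ Subgroup.closure {t | t ∈ T ∧ t y = y} := by
  obtain ⟨L, hL, rfl⟩ := S.exists_list hg
  exact S.stab y hy _ L hL rfl hgy

end Sys
end AffRefl

namespace AffRefl

open Filter Topology

variable {E : Type*} [NormedAddCommGroup E] [InnerProductSpace ℝ E]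

lemma one_dim_pos (a b : ℝ) (hb : 0 < b) : ∀ᶠ ε in 𝓝[>] (0 : ℝ), ∀ n : ℤ,
    a + ε * b ≠ n ∧ ((n : ℝ) < a + ε * b → (n : ℝ) ≤ a) ∧ (a + ε * b < n → a ≤ n) := by
  have hd : 0 < (⌊a⌋ + 1 - a) / b := div_pos (by linarith [Int.lt_floor_add_one a]) hb
  filter_upwards [Ioo_mem_nhdsGT hd] with ε hε n
  have h1 : 0 < ε * b := mul_pos hε.1 hb
  have h2 : a + ε * b < ⌊a⌋ + 1 := by
    have := (lt_div_iff₀ hb).1 hε.2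
    linarith
  have h3 := Int.floor_le a
  have key : (n : ℝ) < a + ε * b → (n : ℝ) ≤ a := by
    intro h
    have : (n : ℝ) < ((⌊a⌋ + 1 : ℤ) : ℝ) := by push_cast; linarith
    have h4 : n ≤ ⌊a⌋ := Int.lt_add_one_iff.1 (Int.cast_lt.1 this)
    have h5 : (n : ℝ) ≤ ⌊a⌋ := Int.cast_le.2 h4
    linarith
  refine ⟨?_, key, fun h => by linarith⟩
  intro h
  have : (n : ℝ) < ((⌊a⌋ + 1 : ℤ) : ℝ) := by push_cast; linarith
  have h4 : n ≤ ⌊a⌋ := Int.lt_add_one_iff.1 (Int.cast_lt.1 this)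
  have h5 : (n : ℝ) ≤ ⌊a⌋ := Int.cast_le.2 h4
  linarith

lemma one_dim (a b : ℝ) (hb : b ≠ 0) : ∀ᶠ ε in 𝓝[>] (0 : ℝ), ∀ n : ℤ,
    a + ε * b ≠ n ∧ ((n : ℝ) < a + ε * b → (n : ℝ) ≤ a) ∧ (a + ε * b < n → a ≤ n) := by
  rcases lt_or_gt_of_ne hb with h | h
  · filter_upwards [one_dim_pos (-a) (-b) (by linarith)] with ε hε n
    obtain ⟨h1, h2, h3⟩ := hε (-n)
    push_cast at h1 h2 h3
    refine ⟨fun h => h1 (by linarith), fun h => ?_, fun h => ?_⟩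
    · have := h3 (by linarith); linarith
    · have := h2 (by linarith); linarith
  · exact one_dim_pos a b h

lemma exists_generic_dir (Φ : Finset E) (hne : ∀ α ∈ Φ, α ≠ 0) :
    ∃ v : E, ∀ α ∈ Φ, ⟪α, v⟫ ≠ 0 := by
  by_contra hcon
  push Not at hcon
  have hcov : ⋃ i : Φ, ((LinearMap.ker (innerₛₗ ℝ (i : E)) : Submodule ℝ E) : Set E)
      = Set.univ := by
    ext v
    simp only [Set.mem_iUnion, Set.mem_univ, iff_true]
    obtain ⟨α, hα, h⟩ := hcon v
    exact ⟨⟨α, hα⟩, by simpa using h⟩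
  obtain ⟨i, hi⟩ := Subspace.exists_eq_top_of_iUnion_eq_univ hcov
  have : (i : E) ∈ LinearMap.ker (innerₛₗ ℝ (i : E)) := by rw [hi]; trivial
  rw [LinearMap.mem_ker] at this
  exact hne i i.2 (inner_self_eq_zero.1 this)

lemma exists_generic (Φ : Finset E) (hne : ∀ α ∈ Φ, α ≠ 0) (H : E) :
    ∃ x : E, ∀ α ∈ Φ, ∀ n : ℤ, ⟪x, α⟫ - n * Real.pi ≠ 0 ∧
      (0 < ⟪x, α⟫ - n * Real.pi → 0 ≤ ⟪H, α⟫ - n * Real.pi) ∧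
      (⟪x, α⟫ - n * Real.pi < 0 → ⟪H, α⟫ - n * Real.pi ≤ 0) := by
  obtain ⟨v, hv⟩ := exists_generic_dir Φ hne
  have hpi := Real.pi_pos
  have hev : ∀ᶠ ε in 𝓝[>] (0 : ℝ), ∀ α ∈ Φ, ∀ n : ℤ,
      ⟪α, H⟫ / Real.pi + ε * (⟪α, v⟫ / Real.pi) ≠ n ∧
      ((n : ℝ) < ⟪α, H⟫ / Real.pi + ε * (⟪α, v⟫ / Real.pi) → (n : ℝ) ≤ ⟪α, H⟫ / Real.pi) ∧
      (⟪α, H⟫ / Real.pi + ε * (⟪α, v⟫ / Real.pi) < n → ⟪α, H⟫ / Real.pi ≤ n) := by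
    rw [Filter.eventually_all_finset]
    intro α hα
    exact one_dim _ _ (div_ne_zero (hv α hα) hpi.ne')
  obtain ⟨ε, hε⟩ := hev.exists
  refine ⟨H + ε • v, fun α hα n => ?_⟩
  obtain ⟨h1, h2, h3⟩ := hε α hα n
  have e : ⟪H + ε • v, α⟫ = (⟪α, H⟫ / Real.pi + ε * (⟪α, v⟫ / Real.pi)) * Real.pi := by
    rw [inner_add_left, real_inner_smul_left, real_inner_comm, real_inner_comm α v]
    field_simp
  have e2 : ⟪H, α⟫ = (⟪α, H⟫ / Real.pi) * Real.pi := by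
    rw [real_inner_comm]; field_simp
  rw [e, e2, ← sub_mul, ← sub_mul]
  refine ⟨mul_ne_zero (sub_ne_zero.2 h1) hpi.ne', fun h => ?_, fun h => ?_⟩
  · have := h2 (by linarith [pos_of_mul_pos_left h hpi.le])
    exact mul_nonneg (by linarith) hpi.le
  · have := h3 (by linarith [neg_of_mul_neg_left h hpi.le])
    exact mul_nonpos_of_nonpos_of_nonneg (by linarith) hpi.le

/-- the affine reflection -/
noncomputable def affR (α : E) (n : ℤ) : Equiv.Perm E :=
  Function.Involutive.toPerm
    (fun y => y - (2 * (⟪y, α⟫ - n * Real.pi) / ⟪α, α⟫) • α) (by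
      intro y
      by_cases h : α = 0
      · simp [h]
      · have h0 : ⟪α, α⟫ ≠ 0 := fun h1 => h (inner_self_eq_zero.1 h1)
        simp only [inner_sub_left, real_inner_smul_left]
        rw [div_mul_cancel₀ _ h0]
        module)

lemma affR_apply (α : E) (n : ℤ) (y : E) :
    affR α n y = y - (2 * (⟪y, α⟫ - n * Real.pi) / ⟪α, α⟫) • α := rfl

lemma affR_conj (α β : E) (hβ : β ≠ 0) (n m c : ℤ) (hc : 2 * ⟪α, β⟫ / ⟪β, β⟫ = c) :
    affR β m * affR α n * affR β m =
      affR (α - (2 * ⟪α, β⟫ / ⟪β, β⟫) • β) (n - m * c) := by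
  ext y
  have h0 : ⟪β, β⟫ ≠ 0 := fun h1 => hβ (inner_self_eq_zero.1 h1)
  have hc' : 2 * ⟪α, β⟫ = c * ⟪β, β⟫ := by rw [← hc]; field_simp
  rw [hc]
  have hnorm : ⟪α - (c : ℝ) • β, α - (c : ℝ) • β⟫ = ⟪α, α⟫ := by
    simp only [inner_sub_left, inner_sub_right, real_inner_smul_left, real_inner_smul_right,
      real_inner_comm α β]
    linear_combination (-(c : ℝ)) * hc'
  have hf : ⟪affR β m y, α⟫ - n * Real.pi =
      ⟪y, α - (c : ℝ) • β⟫ - ((n - m * c : ℤ) : ℝ) * Real.pi := by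
    rw [affR_apply]
    simp only [inner_sub_left, inner_sub_right, real_inner_smul_left, real_inner_smul_right,
      real_inner_comm α β]
    push_cast
    have : 2 * (⟪y, β⟫ - m * Real.pi) / ⟪β, β⟫ * ⟪α, β⟫ = (⟪y, β⟫ - m * Real.pi) * c := by
      rw [← hc]; ring
    rw [this]; ring
  simp only [Equiv.Perm.mul_apply]
  rw [affR_apply α n (affR β m y), hf, affR_apply (α - (c : ℝ) • β), hnorm]
  generalize 2 * (⟪y, α - (c : ℝ) • β⟫ - ((n - m * c : ℤ) : ℝ) * Real.pi) / ⟪α, α⟫ = a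
  rw [affR_apply β m (affR β m y - a • α), inner_sub_left, real_inner_smul_left]
  have h1 : 2 * (⟪affR β m y, β⟫ - a * ⟪α, β⟫ - m * Real.pi) / ⟪β, β⟫ =
      - (2 * (⟪y, β⟫ - m * Real.pi) / ⟪β, β⟫) - a * c := by
    rw [affR_apply, inner_sub_left, real_inner_smul_left, div_mul_cancel₀ _ h0, ← hc]
    ring
  rw [h1, affR_apply β m y]
  module

/-- the linear reflection -/
noncomputable def linR (α : E) : E ≃ₗ[ℝ] E :=
  { affR α 0 with
    map_add' := by
      intro a b
      change affR α 0 (a + b) = affR α 0 a + affR α 0 b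
      simp only [affR_apply, inner_add_left]
      module
    map_smul' := by
      intro c a
      change affR α 0 (c • a) = c • affR α 0 a
      simp only [affR_apply, real_inner_smul_left, Int.cast_zero, zero_mul, sub_zero]
      module }

lemma linR_apply (α y : E) : linR α y = y - (2 * ⟪y, α⟫ / ⟪α, α⟫) • α := by
  change affR α 0 y = _
  rw [affR_apply]; simp

/-- affine reflections of a root system -/
def TT (Φ : Finset E) : Set (Equiv.Perm E) := {t | ∃ α ∈ Φ, ∃ n : ℤ, t = affR α n}

lemma exists_rep (Φ : Finset E) (hne : ∀ α ∈ Φ, α ≠ 0) {x H : E}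
    (hx : ∀ α ∈ Φ, ∀ n : ℤ, ⟪x, α⟫ - n * Real.pi ≠ 0 ∧
      (0 < ⟪x, α⟫ - n * Real.pi → 0 ≤ ⟪H, α⟫ - n * Real.pi) ∧
      (⟪x, α⟫ - n * Real.pi < 0 → ⟪H, α⟫ - n * Real.pi ≤ 0))
    (t : Equiv.Perm E) (ht : t ∈ TT Φ) : ∃ p : E × ℝ, ‖p.1‖ = 1 ∧
      (∀ y, t y = y - (2 * (⟪p.1, y⟫ - p.2)) • p.1) ∧ 0 < ⟪p.1, x⟫ - p.2 ∧
      0 ≤ ⟪p.1, H⟫ - p.2 ∧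
      ∃ α ∈ Φ, ∃ n : ℤ, t = affR α n ∧ ∃ k : ℝ, ∀ y, ⟪p.1, y⟫ - p.2 = k * (⟪y, α⟫ - n * Real.pi) := by
  obtain ⟨α, hα, n, rfl⟩ := ht
  obtain ⟨h1, h2, h3⟩ := hx α hα n
  have hn : ‖α‖ ≠ 0 := norm_ne_zero_iff.2 (hne α hα)
  have hnp : 0 < ‖α‖ := norm_pos_iff.2 (hne α hα)
  have main : ∀ k : ℝ, |k| = ‖α‖⁻¹ → 0 < k * (⟪x, α⟫ - n * Real.pi) →
      0 ≤ k * (⟪H, α⟫ - n * Real.pi) → ∃ p : E × ℝ, ‖p.1‖ = 1 ∧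
      (∀ y, affR α n y = y - (2 * (⟪p.1, y⟫ - p.2)) • p.1) ∧ 0 < ⟪p.1, x⟫ - p.2 ∧
      0 ≤ ⟪p.1, H⟫ - p.2 ∧
      ∃ β ∈ Φ, ∃ m : ℤ, affR α n = affR β m ∧
        ∃ k : ℝ, ∀ y, ⟪p.1, y⟫ - p.2 = k * (⟪y, β⟫ - m * Real.pi) := by
    intro k hk hk1 hk2
    have hF : ∀ y, ⟪k • α, y⟫ - k * (n * Real.pi) = k * (⟪y, α⟫ - n * Real.pi) := by
      intro y; rw [real_inner_smul_left, real_inner_comm]; ring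
    have hk3 : k * k = ⟪α, α⟫⁻¹ := by
      rw [← abs_mul_abs_self, hk, real_inner_self_eq_norm_sq]; field_simp
    refine ⟨(k • α, k * (n * Real.pi)), ?_, ?_, ?_, ?_, α, hα, n, rfl, k, hF⟩
    · rw [norm_smul, Real.norm_eq_abs, hk, inv_mul_cancel₀ hn]
    · intro y
      simp only [hF]
      rw [affR_apply, smul_smul]
      congr 2
      rw [div_eq_mul_inv, ← hk3]; ring
    · simp only [hF]; exact hk1
    · simp only [hF]; exact hk2
  rcases lt_or_gt_of_ne h1 with h | h
  · refine main (-‖α‖⁻¹) (by rw [abs_neg, abs_of_pos (inv_pos.2 hnp)]) ?_ ?_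
    · exact mul_pos_of_neg_of_neg (by simpa using hnp) h
    · exact mul_nonneg_of_nonpos_of_nonpos (by simpa using hnp.le) (h3 h)
  · refine main (‖α‖⁻¹) (by rw [abs_of_pos (inv_pos.2 hnp)]) ?_ ?_
    · exact mul_pos (inv_pos.2 hnp) h
    · exact mul_nonneg (inv_pos.2 hnp).le (h2 h)

lemma finite_sep (Φ : Finset E) (x y : E) :
    {t | ∃ α ∈ Φ, ∃ n : ℤ, t = affR α n ∧
      (⟪x, α⟫ - n * Real.pi) * (⟪y, α⟫ - n * Real.pi) < 0}.Finite := by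
  have hpi := Real.pi_pos
  have hfin : (⋃ α ∈ Φ, (fun n : ℤ => affR α n) ''
      (Set.Icc ⌊min ⟪x, α⟫ ⟪y, α⟫ / Real.pi⌋ ⌈max ⟪x, α⟫ ⟪y, α⟫ / Real.pi⌉)).Finite :=
    Set.Finite.biUnion Φ.finite_toSet fun α _ => (Set.finite_Icc _ _).image _
  refine hfin.subset ?_
  rintro t ⟨α, hα, n, rfl, h⟩
  simp only [Set.mem_iUnion]
  refine ⟨α, hα, n, ⟨?_, ?_⟩, rfl⟩
  · have : min ⟪x, α⟫ ⟪y, α⟫ < n * Real.pi := by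
      by_contra hc
      rw [not_lt, le_min_iff] at hc
      have := mul_nonneg (sub_nonneg.2 hc.1) (sub_nonneg.2 hc.2)
      linarith
    have h2 : min ⟪x, α⟫ ⟪y, α⟫ / Real.pi < n := by rwa [div_lt_iff₀ hpi]
    exact_mod_cast ((Int.floor_le _).trans h2.le)
  · have : n * Real.pi < max ⟪x, α⟫ ⟪y, α⟫ := by
      by_contra hc
      rw [not_lt, max_le_iff] at hc
      have := mul_nonneg_of_nonpos_of_nonpos (sub_nonpos.2 hc.1) (sub_nonpos.2 hc.2)
      linarith
    have h2 : (n : ℝ) < max ⟪x, α⟫ ⟪y, α⟫ / Real.pi := by rwa [lt_div_iff₀ hpi]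
    exact_mod_cast (h2.le.trans (Int.le_ceil _))

theorem stab_TT (Φ : Finset E) (hne : ∀ α ∈ Φ, α ≠ 0)
    (hrefl : ∀ α ∈ Φ, ∀ β ∈ Φ, β - (2 * ⟪β, α⟫ / ⟪α, α⟫) • α ∈ Φ)
    (hint : ∀ α ∈ Φ, ∀ β ∈ Φ, ∃ n : ℤ, 2 * ⟪β, α⟫ / ⟪α, α⟫ = (n : ℝ)) (H : E)
    {g : Equiv.Perm E} (hg : g ∈ Subgroup.closure (TT Φ)) (hgH : g H = H) :
    g ∈ Subgroup.closure {t | t ∈ TT Φ ∧ t H = H} := by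
  classical
  obtain ⟨x, hx⟩ := exists_generic Φ hne H
  choose! P hP using exists_rep Φ hne hx
  have S : Sys (TT Φ) (fun t => (P t).1) (fun t => (P t).2) x := by
    refine ⟨fun t ht => (hP t ht).1, fun t ht => (hP t ht).2.1, fun t ht => (hP t ht).2.2.1,
      ?_, ?_⟩
    · rintro s ⟨β, hβ, m, rfl⟩ t ⟨α, hα, n, rfl⟩
      obtain ⟨c, hc⟩ := hint β hβ α hα
      rw [affR_conj α β (hne β hβ) n m c hc]
      exact ⟨_, hrefl β hβ α hα, _, rfl⟩
    · intro y
      refine (finite_sep Φ x y).subset ?_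
      rintro t ⟨ht, hlt⟩
      obtain ⟨-, -, hpos, -, α, hα, n, e, k, hk⟩ := hP t ht
      refine ⟨α, hα, n, e, ?_⟩
      have hlt : ⟪(P t).1, y⟫ - (P t).2 < 0 := hlt
      rw [hk] at hlt hpos
      have h1 := mul_neg_of_pos_of_neg hpos hlt
      have h2 : k * k * ((⟪x, α⟫ - n * Real.pi) * (⟪y, α⟫ - n * Real.pi)) < 0 := by
        linarith
      exact neg_of_mul_neg_right h2 (mul_self_nonneg k)
  exact S.stab' H (fun t ht => (hP t ht).2.2.2.1) hg hgH

end AffRefl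

open AffRefl in
/-- Theorem `thm-steinberg`(iii): for every `H ∈ E` and every `w` in the Weyl
group `W` of a crystallographic root system `Φ`, one has `wH - H ∈ Γ₀` iff
`w ∈ W₀(H)`; i.e. the centralizer of `H` modulo the fundamental lattice `Γ₀`
coincides with the reflection subgroup `W₀(H)`. -/
theorem centralizer_mod_fundamental_lattice_eq_W0 {E : Type*}
    [NormedAddCommGroup E] [InnerProductSpace ℝ E] [FiniteDimensional ℝ E]
    (Φ : Finset E)
    (hne : ∀ α ∈ Φ, α ≠ 0)
    (hspan : Submodule.span ℝ (Φ : Set E) = ⊤)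
    (hrefl : ∀ α ∈ Φ, ∀ β ∈ Φ, β - (2 * ⟪β, α⟫ / ⟪α, α⟫) • α ∈ Φ)
    (hint : ∀ α ∈ Φ, ∀ β ∈ Φ, ∃ n : ℤ, 2 * ⟪β, α⟫ / ⟪α, α⟫ = (n : ℝ))
    (Γ₀ : AddSubgroup E)
    (hΓ₀ : Γ₀ = AddSubgroup.closure ((fun α : E => (2 * Real.pi / ⟪α, α⟫) • α) '' Φ))
    (W : Subgroup (E ≃ₗ[ℝ] E))
    (hW : W = Subgroup.closure {w : E ≃ₗ[ℝ] E | ∃ α ∈ Φ,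
        ∀ x : E, w x = x - (2 * ⟪x, α⟫ / ⟪α, α⟫) • α})
    (H : E)
    (W₀H : Subgroup (E ≃ₗ[ℝ] E))
    (hW₀H : W₀H = Subgroup.closure {w : E ≃ₗ[ℝ] E | ∃ α ∈ Φ,
        (∃ n : ℤ, ⟪α, H⟫ = (n : ℝ) * Real.pi) ∧
        ∀ x : E, w x = x - (2 * ⟪x, α⟫ / ⟪α, α⟫) • α}) :
    ∀ w ∈ W, (w H - H ∈ Γ₀ ↔ w ∈ W₀H) := by
  intro w hw
  have hαα : ∀ α ∈ Φ, ⟪α, α⟫ ≠ 0 := fun α hα h => hne α hα (inner_self_eq_zero.1 h)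
  have hgen : ∀ α ∈ Φ, (2 * Real.pi / ⟪α, α⟫) • α ∈ Γ₀ := fun α hα => by
    rw [hΓ₀]; exact AddSubgroup.subset_closure ⟨α, hα, rfl⟩
  constructor
  · intro hwH
    -- translations
    have htr : ∀ v ∈ Γ₀, ∃ g ∈ Subgroup.closure (TT Φ), ∀ y, g y = y + v := by
      intro v hv
      rw [hΓ₀] at hv
      induction hv using AddSubgroup.closure_induction with
      | mem v hv =>
        obtain ⟨α, hα, rfl⟩ := hv
        refine ⟨affR α 1 * affR α 0, mul_mem (Subgroup.subset_closure ⟨α, hα, 1, rfl⟩)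
          (Subgroup.subset_closure ⟨α, hα, 0, rfl⟩), ?_⟩
        intro y
        have h0 := hαα α hα
        rw [Equiv.Perm.mul_apply, affR_apply α 1, affR_apply α 0, inner_sub_left,
          real_inner_smul_left, div_mul_cancel₀ _ h0]
        push_cast
        module
      | zero => exact ⟨1, one_mem _, by simp⟩
      | add u v _ _ hu hv =>
        obtain ⟨g, hg, hg2⟩ := hu
        obtain ⟨h, hh, hh2⟩ := hv
        refine ⟨g * h, mul_mem hg hh, fun y => ?_⟩
        rw [Equiv.Perm.mul_apply, hg2, hh2]; abel
      | neg u _ hu =>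
        obtain ⟨g, hg, hg2⟩ := hu
        refine ⟨g⁻¹, inv_mem hg, fun y => ?_⟩
        rw [Equiv.Perm.inv_eq_iff_eq, hg2]; abel
    have hlin : ∃ g ∈ Subgroup.closure (TT Φ), ∀ y, g y = w y := by
      clear hwH
      rw [hW] at hw
      induction hw using Subgroup.closure_induction with
      | mem w hw =>
        obtain ⟨α, hα, h⟩ := hw
        refine ⟨affR α 0, Subgroup.subset_closure ⟨α, hα, 0, rfl⟩, fun y => ?_⟩
        rw [affR_apply, h]; simp
      | one => exact ⟨1, one_mem _, by simp⟩
      | mul u v _ _ hu hv =>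
        obtain ⟨g, hg, hg2⟩ := hu
        obtain ⟨h, hh, hh2⟩ := hv
        refine ⟨g * h, mul_mem hg hh, fun y => ?_⟩
        rw [Equiv.Perm.mul_apply, hg2, hh2]; rfl
      | inv u _ hu =>
        obtain ⟨g, hg, hg2⟩ := hu
        refine ⟨g⁻¹, inv_mem hg, fun y => ?_⟩
        rw [Equiv.Perm.inv_eq_iff_eq, hg2]
        exact (u.apply_symm_apply y).symm
    obtain ⟨a, ha, ha2⟩ := htr _ (neg_mem hwH)
    obtain ⟨b, hb, hb2⟩ := hlin
    have hst := stab_TT Φ hne hrefl hint H (mul_mem ha hb)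
      (by rw [Equiv.Perm.mul_apply, ha2, hb2]; abel)
    have hback : ∀ g ∈ Subgroup.closure {t | t ∈ TT Φ ∧ t H = H},
        ∃ u ∈ W₀H, ∀ y, g y = u (y - H) + H := by
      intro g hg
      induction hg using Subgroup.closure_induction with
      | mem t ht =>
        obtain ⟨⟨α, hα, n, rfl⟩, htH⟩ := ht
        have h0 := hαα α hα
        have hn : ⟪H, α⟫ = n * Real.pi := by
          rw [affR_apply, sub_eq_self, smul_eq_zero, div_eq_zero_iff] at htH
          rcases htH with (h | h) | h
          · linarith
          · exact absurd h h0
          · exact absurd h (hne α hα)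
        refine ⟨linR α, ?_, fun y => ?_⟩
        · rw [hW₀H]
          exact Subgroup.subset_closure
            ⟨α, hα, ⟨n, by rw [real_inner_comm]; exact hn⟩, linR_apply α⟩
        · rw [linR_apply, affR_apply, inner_sub_left, hn]
          module
      | one => exact ⟨1, one_mem _, by simp⟩
      | mul a b _ _ iha ihb =>
        obtain ⟨u, hu, hu2⟩ := iha
        obtain ⟨v, hv, hv2⟩ := ihb
        refine ⟨u * v, mul_mem hu hv, fun y => ?_⟩
        rw [Equiv.Perm.mul_apply, hu2, hv2, add_sub_cancel_right]; rfl
      | inv a _ iha =>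
        obtain ⟨u, hu, hu2⟩ := iha
        refine ⟨u⁻¹, inv_mem hu, fun y => ?_⟩
        rw [Equiv.Perm.inv_eq_iff_eq, hu2, add_sub_cancel_right]
        have : u (u⁻¹ (y - H)) = y - H := u.apply_symm_apply _
        rw [this]; abel
    obtain ⟨u, hu, hu2⟩ := hback _ hst
    have : w = u := by
      ext y
      have h1 := hu2 (y + H)
      rw [Equiv.Perm.mul_apply, ha2, hb2, map_add, add_sub_cancel_right] at h1
      have h2 : w y + H = u y + H := by rw [← h1]; abel
      exact add_right_cancel h2
    rw [this]; exact hu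
  · intro hw0
    have hpair : ∀ v ∈ Γ₀, ∀ β ∈ Φ, ∃ n : ℤ, ⟪v, β⟫ = n * Real.pi := by
      intro v hv β hβ
      rw [hΓ₀] at hv
      induction hv using AddSubgroup.closure_induction with
      | mem v hv =>
        obtain ⟨α, hα, rfl⟩ := hv
        obtain ⟨n, hn⟩ := hint α hα β hβ
        refine ⟨n, ?_⟩
        simp only
        rw [← hn, real_inner_smul_left, real_inner_comm β α]; ring
      | zero => exact ⟨0, by simp⟩
      | add u v _ _ hu hv =>
        obtain ⟨n, hn⟩ := hu
        obtain ⟨m, hm⟩ := hv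
        exact ⟨n + m, by rw [inner_add_left, hn, hm]; push_cast; ring⟩
      | neg u _ hu =>
        obtain ⟨n, hn⟩ := hu
        exact ⟨-n, by rw [inner_neg_left, hn]; push_cast; ring⟩
    have step : ∀ α ∈ Φ, (∃ n : ℤ, ⟪α, H⟫ = (n : ℝ) * Real.pi) → ∀ z, z - H ∈ Γ₀ →
        z - (2 * ⟪z, α⟫ / ⟪α, α⟫) • α - H ∈ Γ₀ := by
      rintro α hα ⟨n, hn⟩ z hz
      obtain ⟨m, hm⟩ := hpair _ hz α hα
      have e : ⟪z, α⟫ = ((n + m : ℤ) : ℝ) * Real.pi := by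
        rw [inner_sub_left, real_inner_comm α H, hn] at hm
        push_cast; linarith
      have e2 : z - (2 * ⟪z, α⟫ / ⟪α, α⟫) • α - H =
          (z - H) - (n + m) • ((2 * Real.pi / ⟪α, α⟫) • α) := by
        rw [e, ← Int.cast_smul_eq_zsmul ℝ]
        module
      rw [e2]
      exact sub_mem hz (zsmul_mem (hgen α hα) _)
    clear hw
    rw [hW₀H] at hw0
    induction hw0 using Subgroup.closure_induction_left with
    | one => simp
    | mul_left r hr g _ ih =>
      obtain ⟨α, hα, hn, h⟩ := hr
      change r (g H) - H ∈ Γ₀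
      rw [h]
      exact step α hα hn _ ih
    | inv_mul_cancel r hr g _ ih =>
      obtain ⟨α, hα, hn, h⟩ := hr
      change r.symm (g H) - H ∈ Γ₀
      have e : r.symm (g H) = r (g H) := by
        rw [LinearEquiv.symm_apply_eq, h (r (g H)), h (g H), inner_sub_left,
          real_inner_smul_left, div_mul_cancel₀ _ (hαα α hα)]
        module
      rw [e, h]
      exact step α hα hn _ ih
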